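/- Let A be a PSD d×d matrix, γ ∈ (0, 1/20), and p ∈ ℕ with p ≥ (C/γ)·log(d/γ) for a sufficiently large absolute constant C. For z ∼ N(0, I_d) and u := A^p z, with probability at least 1/2 over z we have u^T A u / ‖u‖₂² ≥ (1 − γ)‖A‖_op. -/

import Mathlib

open Matrix MeasureTheory ProbabilityTheory

/-- The ℓ₂ → ℓ₂ operator norm of a matrix: sup over unit vectors x of ‖Ax‖₂. -/
noncomputable def l2OpNorm {d : ℕ} (A : Matrix (Fin d) (Fin d) ℝ) : ℝ :=
  ⨆ x : {x : Fin d → ℝ // ∑ i, (x i) ^ 2 = 1},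
    Real.sqrt (∑ i, (A.mulVec x.1 i) ^ 2)

lemma map_lin {d : ℕ} (w : Fin d → ℝ) (hw : ∑ i, w i ^ 2 = 1) :
    (Measure.pi fun _ : Fin d => gaussianReal 0 1).map (fun z => ∑ i, w i * z i)
      = gaussianReal 0 1 := by
  have hm : Measurable (fun z : Fin d → ℝ => ∑ i, w i * z i) := by fun_prop
  have := Measure.isProbabilityMeasure_map
    (μ := Measure.pi fun _ : Fin d => gaussianReal 0 1) hm.aemeasurable
  apply Measure.ext_of_charFun
  ext t
  rw [charFun_apply_real, integral_map hm.aemeasurable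
    (Measurable.aestronglyMeasurable (by fun_prop))]
  have : ∀ z : Fin d → ℝ, Complex.exp (t * ((∑ i, w i * z i : ℝ) : ℂ) * Complex.I)
      = ∏ i, Complex.exp (((t * w i : ℝ) : ℂ) * (z i) * Complex.I) := by
    intro z
    rw [← Complex.exp_sum]
    congr 1
    push_cast
    rw [Finset.mul_sum, Finset.sum_mul]
    exact Finset.sum_congr rfl fun i _ => by ring
  simp_rw [this]
  rw [integral_fintype_prod_eq_prod
    (f := fun i (x : ℝ) => Complex.exp (((t * w i : ℝ) : ℂ) * x * Complex.I))]
  simp_rw [← charFun_apply_real, charFun_gaussianReal]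
  rw [← Complex.exp_sum]
  congr 1
  have h2 : (∑ i, (w i : ℂ) ^ 2) = 1 := by exact_mod_cast hw
  calc _ = ∑ i, -((t:ℂ)^2/2) * (w i : ℂ)^2 := by
        refine Finset.sum_congr rfl fun i _ => ?_
        push_cast; ring
    _ = _ := by rw [← Finset.mul_sum, h2]; push_cast; ring

lemma small_ball : (gaussianReal 0 1).real {x : ℝ | |x| < 1/4} ≤ 1/4 := by
  have hs : {x : ℝ | |x| < 1/4} = Set.Ioo (-(1/4)) (1/4) := by
    ext x; simp [abs_lt]
  rw [hs, Measure.real, gaussianReal_apply 0 (by norm_num)]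
  apply ENNReal.toReal_le_of_le_ofReal (by norm_num)
  calc _ ≤ ∫⁻ x in Set.Ioo (-(1/4):ℝ) (1/4), ENNReal.ofReal (1/2) := by
        apply lintegral_mono
        intro x
        rw [gaussianPDF]
        apply ENNReal.ofReal_le_ofReal
        rw [gaussianPDFReal]
        have h1 : (2:ℝ) ≤ √(2 * Real.pi * ((1 : NNReal) : ℝ)) := by
          apply Real.le_sqrt_of_sq_le
          have := Real.pi_gt_three
          norm_num; linarith
        have h2 : (√(2 * Real.pi * ((1 : NNReal) : ℝ)))⁻¹ ≤ 1/2 := by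
          rw [one_div]; exact inv_anti₀ (by norm_num) h1
        have h3 : Real.exp (-(x - 0) ^ 2 / (2 * ((1 : NNReal) : ℝ))) ≤ 1 := by
          apply Real.exp_le_one_iff.2
          have h4 : (0:ℝ) ≤ (x - 0) ^ 2 := sq_nonneg _
          have h5 : -(x - 0) ^ 2 / (2 * ((1 : NNReal) : ℝ)) = -((x - 0) ^ 2 / 2) := by
            push_cast; ring
          rw [h5]; linarith
        calc _ ≤ 1/2 * (1:ℝ) := by gcongr
          _ = _ := by norm_num
    _ = _ := by
      simp only [lintegral_const, Measure.restrict_apply MeasurableSet.univ, Set.univ_inter,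
        Real.volume_Ioo]
      rw [← ENNReal.ofReal_mul (by norm_num)]
      norm_num

lemma norm_tail {d : ℕ} (hd : 0 < d) :
    (Measure.pi fun _ : Fin d => gaussianReal 0 1).real {z | 4 * (d:ℝ) ≤ ∑ i, z i ^ 2} ≤ 1/4 := by
  have hint : ∀ i : Fin d, Integrable (fun z : Fin d → ℝ => z i ^ 2)
      (Measure.pi fun _ : Fin d => gaussianReal 0 1) := by
    intro i
    have : Integrable (fun x : ℝ => x ^ 2) (gaussianReal 0 1) :=
      (memLp_id_gaussianReal' 2 (by norm_num)).integrable_sq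
    exact integrable_comp_eval (μ := fun _ : Fin d => gaussianReal 0 1) (i := i) (f := fun x : ℝ => x ^ 2) this
  have h1 : ∫ z, ∑ i, z i ^ 2 ∂(Measure.pi fun _ : Fin d => gaussianReal 0 1) = d := by
    rw [integral_finsetSum _ (fun i _ => hint i)]
    have : ∀ i : Fin d, ∫ z, z i ^ 2 ∂(Measure.pi fun _ : Fin d => gaussianReal 0 1) = 1 := by
      intro i
      rw [integral_comp_eval (μ := fun _ : Fin d => gaussianReal 0 1) (i := i)
        (f := fun x : ℝ => x ^ 2) (by fun_prop)]
      have := variance_of_integral_eq_zero (μ := gaussianReal 0 1) (X := id) (by fun_prop)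
        (by simp)
      rw [variance_id_gaussianReal] at this
      simpa using this.symm
    simp [this]
  have h := mul_meas_ge_le_integral_of_nonneg
    (μ := Measure.pi fun _ : Fin d => gaussianReal 0 1)
    (f := fun z => ∑ i, z i ^ 2) (ae_of_all _ fun z => Finset.sum_nonneg fun i _ => sq_nonneg _)
    (integrable_finsetSum _ fun i _ => hint i) (4 * d)
  rw [h1] at h
  have hd' : (0:ℝ) < d := by exact_mod_cast hd
  by_contra hc
  push Not at hc
  nlinarith

lemma quad {d : ℕ} (A : Matrix (Fin d) (Fin d) ℝ) (hA : A.IsHermitian) (k : ℕ) (x : Fin d → ℝ) :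
    x ⬝ᵥ (A ^ k) *ᵥ x = ∑ i, hA.eigenvalues i ^ k * (∑ j, hA.eigenvectorBasis i j * x j) ^ 2 := by
  have h := hA.spectral_theorem
  have hk : A ^ k = (hA.eigenvectorUnitary : Matrix (Fin d) (Fin d) ℝ) *
      diagonal (fun i => hA.eigenvalues i ^ k) * star (hA.eigenvectorUnitary : Matrix (Fin d) (Fin d) ℝ) := by
    conv_lhs => rw [h, ← map_pow, Unitary.conjStarAlgAut_apply, diagonal_pow]
    rfl
  rw [hk, ← mulVec_mulVec, ← mulVec_mulVec, dotProduct_mulVec, ← mulVec_transpose]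
  have h2 : ∀ y : Fin d → ℝ, ∀ i, ((hA.eigenvectorUnitary : Matrix (Fin d) (Fin d) ℝ)ᵀ *ᵥ y) i
      = ∑ j, hA.eigenvectorBasis i j * y j := by
    intro y i
    rfl
  have h3 : star (hA.eigenvectorUnitary : Matrix (Fin d) (Fin d) ℝ) = (hA.eigenvectorUnitary : Matrix (Fin d) (Fin d) ℝ)ᵀ := by
    rw [star_eq_conjTranspose, conjTranspose_eq_transpose_of_trivial]
  rw [h3]
  simp only [dotProduct, mulVec_diagonal, h2]
  exact Finset.sum_congr rfl fun i _ => by ring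

lemma sum_sq_mulVec {d : ℕ} (A : Matrix (Fin d) (Fin d) ℝ) (hA : A.IsHermitian) (x : Fin d → ℝ) (p k : ℕ) :
    ((A ^ p) *ᵥ x) ⬝ᵥ (A ^ k) *ᵥ ((A ^ p) *ᵥ x) = x ⬝ᵥ (A ^ (2 * p + k)) *ᵥ x := by
  have ht : (A ^ p)ᵀ = A ^ p := by
    have := hA.pow p
    rwa [IsHermitian, conjTranspose_eq_transpose_of_trivial] at this
  rw [dotProduct_comm, dotProduct_mulVec, ← mulVec_transpose, ht, mulVec_mulVec, mulVec_mulVec, ← pow_add, ← pow_add,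
   dotProduct_comm]
  congr 3
  omega

lemma op_le {d : ℕ} (hd : 0 < d) (A : Matrix (Fin d) (Fin d) ℝ) (hA : A.IsHermitian) (m : ℝ) (hm : 0 ≤ m)
    (h0 : ∀ i, 0 ≤ hA.eigenvalues i) (h : ∀ i, hA.eigenvalues i ≤ m) : l2OpNorm A ≤ m := by
  have : Nonempty {x : Fin d → ℝ // ∑ i, (x i) ^ 2 = 1} :=
    ⟨⟨Pi.single ⟨0, hd⟩ 1, by simp [Pi.single_apply]⟩⟩
  apply ciSup_le
  rintro ⟨x, hx⟩
  apply Real.sqrt_le_iff.2 ⟨hm, ?_⟩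
  have e1 := sum_sq_mulVec A hA x 1 0
  rw [quad A hA (2 * 1 + 0)] at e1
  have e2 := quad A hA 0 x
  simp only [pow_zero, one_mulVec, one_mul, pow_one, dotProduct, ← sq, mul_one, add_zero] at e1 e2
  rw [hx] at e2
  simp only
  rw [e1]
  calc _ ≤ ∑ i, m ^ 2 * (∑ j, hA.eigenvectorBasis i j * x j) ^ 2 := by
        gcongr with i
        · exact h0 i
        · exact h i
    _ = m ^ 2 := by rw [← Finset.mul_sum, ← e2, mul_one]

lemma numeric {d : ℕ} (hd : 0 < d) {γ : ℝ} (h0 : 0 < γ) (h1 : γ < 1/20) {p : ℕ}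
    (hp : (2 / γ) * Real.log (d / γ) ≤ p) : (1 - γ) ^ (2 * p) * (4 * d) ≤ γ / 16 := by
  have hd' : (1:ℝ) ≤ d := by exact_mod_cast hd
  have e1 : (1 - γ) ^ (2 * p) ≤ (γ / d) ^ 4 := by
    have a1 : (1 - γ) ≤ Real.exp (-γ) := by linarith [Real.add_one_le_exp (-γ)]
    calc (1 - γ) ^ (2 * p) ≤ Real.exp (-γ) ^ (2*p) := by
          gcongr; linarith
      _ = Real.exp (-(2 * (γ * p))) := by
          rw [← Real.exp_nat_mul]; congr 1; push_cast; ring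
      _ ≤ Real.exp (4 * Real.log (γ / d)) := by
          apply Real.exp_le_exp.2
          have : Real.log (γ / d) = - Real.log (d / γ) := by
            rw [← Real.log_inv, inv_div]
          rw [this]
          have h3 : γ * ((2 / γ) * Real.log (d / γ)) ≤ γ * p := by gcongr
          have h4 : γ * ((2 / γ) * Real.log (d / γ)) = 2 * Real.log (d/γ) := by field_simp
          linarith
      _ = (γ / d) ^ 4 := by
          have := Real.exp_nat_mul (Real.log (γ/d)) 4
          push_cast at this
          rw [this, Real.exp_log (by positivity)]
  calc _ ≤ (γ / d) ^ 4 * (4 * d) := by gcongr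
    _ = 4 * γ ^ 4 / d ^ 3 := by field_simp
    _ ≤ 4 * γ ^ 4 / 1 := by gcongr; exact one_le_pow₀ hd'
    _ = γ * (4 * γ ^ 3) := by ring
    _ ≤ γ * (4 * (1/20) ^ 3) := by gcongr
    _ ≤ γ / 16 := by linarith

lemma key {d : ℕ} {γ m : ℝ} {p : ℕ} (h0 : 0 < γ) (h1 : γ < 1/20) (hm : 0 < m) (l c : Fin d → ℝ)
    (hl0 : ∀ i, 0 ≤ l i) (i₀ : Fin d) (hi : l i₀ = m)
    (hc : (1 - γ) ^ (2 * p) * ∑ i, c i ^ 2 ≤ γ * c i₀ ^ 2) :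
    (1 - γ) * m * ∑ i, l i ^ (2 * p) * c i ^ 2 ≤ ∑ i, l i ^ (2 * p + 1) * c i ^ 2 := by
  rw [Finset.mul_sum, ← sub_nonneg, ← Finset.sum_sub_distrib]
  have hterm : ∀ i, (if i = i₀ then γ * m ^ (2 * p + 1) * c i ^ 2 else 0)
      - (1 - γ) ^ (2 * p) * m ^ (2 * p + 1) * c i ^ 2 ≤
      l i ^ (2 * p + 1) * c i ^ 2 - (1 - γ) * m * (l i ^ (2 * p) * c i ^ 2) := by
    intro i
    have hg : 0 ≤ 1 - γ := by linarith
    have hnn : 0 ≤ (1 - γ) ^ (2 * p) * m ^ (2 * p + 1) * c i ^ 2 := by positivity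
    have hrw : l i ^ (2 * p + 1) * c i ^ 2 - (1 - γ) * m * (l i ^ (2 * p) * c i ^ 2)
      = (l i - (1 - γ) * m) * (l i ^ (2 * p) * c i ^ 2) := by ring
    split_ifs with h
    · subst h
      rw [hrw, hi]
      have : (m - (1 - γ) * m) * (m ^ (2 * p) * c i ^ 2) = γ * m ^ (2 * p + 1) * c i ^ 2 := by ring
      linarith
    · rw [hrw]
      rcases le_total ((1 - γ) * m) (l i) with h2 | h2
      · have : 0 ≤ (l i - (1 - γ) * m) * (l i ^ (2 * p) * c i ^ 2) :=
          mul_nonneg (by linarith) (mul_nonneg (pow_nonneg (hl0 i) _) (sq_nonneg _))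
        linarith
      · have h3 : l i ^ (2 * p) ≤ ((1 - γ) * m) ^ (2 * p) := pow_le_pow_left₀ (hl0 i) h2 _
        have h4 : ((1 - γ) * m - l i) * (l i ^ (2 * p) * c i ^ 2) ≤
            m * (((1 - γ) * m) ^ (2 * p) * c i ^ 2) := by
          apply mul_le_mul
          · nlinarith [hl0 i]
          · gcongr
          · exact mul_nonneg (pow_nonneg (hl0 i) _) (sq_nonneg _)
          · exact hm.le
        have h5 : m * (((1 - γ) * m) ^ (2 * p) * c i ^ 2) =
          (1 - γ) ^ (2 * p) * m ^ (2 * p + 1) * c i ^ 2 := by rw [mul_pow]; ring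
        linarith
  refine le_trans ?_ (Finset.sum_le_sum fun i _ => hterm i)
  rw [Finset.sum_sub_distrib, ← Finset.mul_sum, Finset.sum_ite_eq' Finset.univ i₀]
  simp only [Finset.mem_univ, if_true]
  have := mul_le_mul_of_nonneg_left hc (pow_nonneg hm.le (2 * p + 1))
  linarith

lemma main_aux (d : ℕ) (hd : 0 < d) (A : Matrix (Fin d) (Fin d) ℝ) (hP : A.PosSemidef)
    (γ : ℝ) (h0 : 0 < γ) (h1 : γ < 1 / 20) (p : ℕ) (hp : (2 / γ) * Real.log (d / γ) ≤ p) :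
    (1 : ℝ) / 2 ≤
              ((Measure.pi fun _ : Fin d => gaussianReal 0 1)
                {z : Fin d → ℝ |
                  (1 - γ) * l2OpNorm A ≤
                    (((A ^ p).mulVec z) ⬝ᵥ A.mulVec ((A ^ p).mulVec z)) /
                      ∑ i, ((A ^ p).mulVec z i) ^ 2}).toReal := by
  set S := {z : Fin d → ℝ |
                  (1 - γ) * l2OpNorm A ≤
                    (((A ^ p).mulVec z) ⬝ᵥ A.mulVec ((A ^ p).mulVec z)) /
                      ∑ i, ((A ^ p).mulVec z i) ^ 2} with hS
  set μ := (Measure.pi fun _ : Fin d => gaussianReal 0 1) with hμ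
  have hA : A.IsHermitian := hP.isHermitian
  have hl0 : ∀ i, 0 ≤ hA.eigenvalues i := hP.eigenvalues_nonneg
  have : Nonempty (Fin d) := ⟨⟨0, hd⟩⟩
  obtain ⟨i₀, hi₀⟩ := Finite.exists_max hA.eigenvalues
  set m := hA.eigenvalues i₀ with hm
  have hop : l2OpNorm A ≤ m := op_le hd A hA m (hl0 i₀) hl0 hi₀
  set c : (Fin d → ℝ) → Fin d → ℝ := fun z i => ∑ j, hA.eigenvectorBasis i j * z j with hc
  have hw : ∑ j, hA.eigenvectorBasis i₀ j ^ 2 = 1 := by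
    have := hA.eigenvectorBasis.orthonormal.1 i₀
    rw [EuclideanSpace.norm_eq, Real.sqrt_eq_one] at this
    simpa using this
  have hB1 : μ.real {z | |c z i₀| < 1/4} ≤ 1/4 := by
    have hmap := map_lin _ hw
    have := small_ball
    rw [← hmap, map_measureReal_apply (by fun_prop)
      (measurableSet_lt (by fun_prop) (by fun_prop))] at this
    exact this
  have hB2 := norm_tail hd
  rw [← hμ] at hB2
  have hsub : Set.univ ⊆ S ∪ ({z | |c z i₀| < 1/4} ∪ {z | 4 * (d:ℝ) ≤ ∑ i, z i ^ 2}) := by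
    intro z _
    by_cases hz1 : |c z i₀| < 1/4
    · right; left; exact hz1
    by_cases hz2 : 4 * (d:ℝ) ≤ ∑ i, z i ^ 2
    · right; right; exact hz2
    left
    push Not at hz1 hz2
    have e0 := quad A hA 0 z
    have e1 := sum_sq_mulVec A hA z p 0
    have e2 := sum_sq_mulVec A hA z p 1
    rw [quad A hA (2 * p + 0)] at e1
    rw [quad A hA (2 * p + 1)] at e2
    simp only [pow_zero, one_mulVec, one_mul, pow_one, add_zero] at e0 e1 e2
    simp only [dotProduct, ← sq] at e0 e1
    change (1 - γ) * l2OpNorm A ≤ _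
    rw [e1, e2]
    have hcp : 1/16 ≤ c z i₀ ^ 2 := by
      rw [← sq_abs]; nlinarith
    rcases (hl0 i₀).eq_or_lt with hm0 | hm0
    · have : (1 - γ) * l2OpNorm A ≤ 0 :=
        mul_nonpos_of_nonneg_of_nonpos (by linarith) (by linarith)
      refine this.trans (div_nonneg ?_ ?_) <;>
      exact Finset.sum_nonneg fun i _ => mul_nonneg (pow_nonneg (hl0 i) _) (sq_nonneg _)
    · have hpos : 0 < ∑ i, hA.eigenvalues i ^ (2 * p) * c z i ^ 2 := by
        refine Finset.sum_pos' (fun i _ => mul_nonneg (pow_nonneg (hl0 i) _) (sq_nonneg _))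
          ⟨i₀, Finset.mem_univ _, mul_pos (pow_pos hm0 _) (by linarith)⟩
      rw [le_div_iff₀ hpos]
      have hcond : (1 - γ) ^ (2 * p) * ∑ i, c z i ^ 2 ≤ γ * c z i₀ ^ 2 := by
        have hn := numeric hd h0 h1 hp
        have h5 : ∑ i, c z i ^ 2 ≤ 4 * d := by rw [← e0]; exact hz2.le
        have hg : 0 ≤ 1 - γ := by linarith
        calc _ ≤ (1 - γ) ^ (2 * p) * (4 * d) := by gcongr
          _ ≤ γ / 16 := hn
          _ = γ * (1/16) := by ring
          _ ≤ _ := by gcongr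
      refine le_trans ?_ (key h0 h1 hm0 hA.eigenvalues (c z) hl0 i₀ rfl hcond)
      have : (1 - γ) * l2OpNorm A ≤ (1 - γ) * m := mul_le_mul_of_nonneg_left hop (by linarith)
      exact mul_le_mul_of_nonneg_right this hpos.le
  have hfin : μ.real Set.univ ≤ μ.real S + (μ.real {z | |c z i₀| < 1/4} +
      μ.real {z | 4 * (d:ℝ) ≤ ∑ i, z i ^ 2}) :=
    (measureReal_mono hsub).trans ((measureReal_union_le _ _).trans
      (by gcongr; exact measureReal_union_le _ _))
  rw [probReal_univ] at hfin
  change 1 / 2 ≤ μ.real S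
  linarith

theorem power_iteration_guarantee :
    ∃ C : ℝ, 0 < C ∧
      ∀ (d : ℕ) (A : Matrix (Fin d) (Fin d) ℝ), A.PosSemidef →
        ∀ γ : ℝ, 0 < γ → γ < 1 / 20 →
          ∀ p : ℕ, (C / γ) * Real.log (d / γ) ≤ p →
            (1 : ℝ) / 2 ≤
              ((Measure.pi fun _ : Fin d => gaussianReal 0 1)
                {z : Fin d → ℝ |
                  (1 - γ) * l2OpNorm A ≤
                    (((A ^ p).mulVec z) ⬝ᵥ A.mulVec ((A ^ p).mulVec z)) /
                      ∑ i, ((A ^ p).mulVec z i) ^ 2}).toReal := by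
  refine ⟨2, by norm_num, ?_⟩
  intro d A hA γ h0 h1 p hp
  rcases Nat.eq_zero_or_pos d with hd | hd
  · subst hd
    have : IsEmpty {x : Fin 0 → ℝ // ∑ i, (x i) ^ 2 = 1} := ⟨fun x => by simpa using x.2⟩
    have : l2OpNorm A = 0 := by
      unfold l2OpNorm
      exact Real.iSup_of_isEmpty _
    norm_num [this]
  · exact main_aux d hd A hA γ h0 h1 p hp
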